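/- Let X be a standard Borel space with a probability measure ρ, let μ and ν be probability measures on ℝ^d, let ε > 0, let c : X × ℝ^d → ℝ be measurable with c(x,·) continuously differentiable for every x, and let ω : ℝ^d × ℝ^d → ℝ be a non-negative measurable function. Suppose there exist measurable functions φ^ν, ψ^ν, φ^μ, ψ^μ such that: (a) the measure π^ν with density exp(−(c(x,y)+φ^ν(x)+ψ^ν(y))/ε) with respect to ρ⊗ν is a probability measure with marginals ρ and ν, and the measure π^μ with density exp(−(c(x,y)+φ^μ(x)+ψ^μ(y))/ε) with respect to ρ⊗μ is a probability measure with marginals ρ and μ; (b) for every y ∈ ℝ^d, π^ν(dx|y) := exp(−(c(x,y)+φ^ν(x)+ψ^ν(y))/ε) ρ(dx) is a probability measure, ψ^ν is differentiable, and ∇ψ^ν(y) = −∫_X ∇₂c(x,y) π^ν(dx|y) for every y; (c) there exists Λ > 0 such that for every x in the support of ρ the map y ↦ c(x,y) + ψ^ν(y) is (Λ,ω)-semiconcave. Then KL(π^μ | π^ν) ≤ KL(μ | ν) + (Λ/(2ε)) · W_ω(μ, ν). -/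

import Mathlib

open MeasureTheory Real ENNReal Filter
open scoped RealInnerProductSpace

noncomputable section

open Classical in
/-- The Kullback--Leibler divergence `KL(μ|ν)`: `∫ log (dμ/dν) dμ` if `μ ≪ ν`, `+∞` otherwise. -/
def KL {α : Type*} [MeasurableSpace α] (μ ν : Measure α) : ℝ≥0∞ :=
  if μ ≪ ν then ENNReal.ofReal (∫ x, Real.log (μ.rnDeriv ν x).toReal ∂μ) else ⊤

/-- The (topological) support of a measure. -/
def msupport {α : Type*} [TopologicalSpace α] [MeasurableSpace α] (μ : Measure α) : Set α :=
  {x | ∀ U : Set α, IsOpen U → x ∈ U → 0 < μ U}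

/-- The generalized transport cost `W_ω(μ, ν)`: the infimum of `∫ ω(z, y) dπ(z, y)` over
couplings `π` of `(μ, ν)`. -/
def Wcost {α : Type*} [MeasurableSpace α] (ω : α → α → ℝ) (μ ν : Measure α) : ℝ≥0∞ :=
  ⨅ (P : Measure (α × α)) (_ : P.map Prod.fst = μ ∧ P.map Prod.snd = ν),
    ∫⁻ p, ENNReal.ofReal (ω p.1 p.2) ∂P

/-- The squared Wasserstein distance of order two. -/
def W2sq {α : Type*} [MeasurableSpace α] [NormedAddCommGroup α] (μ ν : Measure α) : ℝ≥0∞ :=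
  Wcost (fun y z => ‖y - z‖ ^ 2) μ ν

/-- Talagrand's transport inequality `TI(τ)` for `ν`. -/
def TI {α : Type*} [MeasurableSpace α] [NormedAddCommGroup α] (τ : ℝ) (ν : Measure α) : Prop :=
  ∀ μ : Measure α, IsProbabilityMeasure μ → W2sq μ ν ≤ ENNReal.ofReal (2 * τ) * KL μ ν

/-- The generalized transport inequality `TI_ω(τ)` for `ν`. -/
def TIcost {α : Type*} [MeasurableSpace α] (ω : α → α → ℝ) (τ : ℝ) (ν : Measure α) : Prop :=
  ∀ μ : Measure α, IsProbabilityMeasure μ → Wcost ω μ ν ≤ ENNReal.ofReal (2 * τ) * KL μ ν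

/-- `Λ`-semiconcavity of a (differentiable) function on an inner product space. -/
def Semiconcave {E : Type*} [NormedAddCommGroup E] [InnerProductSpace ℝ E] [CompleteSpace E]
    (Λ : ℝ) (f : E → ℝ) : Prop :=
  ∀ y z : E, f z - f y ≤ ⟪gradient f y, z - y⟫ + Λ / 2 * ‖z - y‖ ^ 2

/-- `(Λ, ω)`-semiconcavity of a (differentiable) function on an inner product space. -/
def SemiconcaveW {E : Type*} [NormedAddCommGroup E] [InnerProductSpace ℝ E] [CompleteSpace E]
    (Λ : ℝ) (ω : E → E → ℝ) (f : E → ℝ) : Prop :=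
  ∀ y z : E, f z - f y ≤ ⟪gradient f y, z - y⟫ + Λ / 2 * ω z y

/-- The plan with density `exp(-(c(x,y) + f(x) + g(y))/ε)` with respect to `ρ ⊗ ν`. -/
def plan {X Y : Type*} [MeasurableSpace X] [MeasurableSpace Y]
    (ρ : Measure X) (ν : Measure Y) [SFinite ν] (ε : ℝ) (c : X → Y → ℝ)
    (f : X → ℝ) (g : Y → ℝ) : Measure (X × Y) :=
  (ρ.prod ν).withDensity fun p => ENNReal.ofReal (Real.exp (-(c p.1 p.2 + f p.1 + g p.2) / ε))

/-- The conditional plan given the second coordinate `y`: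
`π(dx|y) = exp(-(c(x,y) + f(x) + g(y))/ε) ρ(dx)`. -/
def condSnd {X Y : Type*} [MeasurableSpace X]
    (ρ : Measure X) (ε : ℝ) (c : X → Y → ℝ) (f : X → ℝ) (g : Y → ℝ) (y : Y) : Measure X :=
  ρ.withDensity fun x => ENNReal.ofReal (Real.exp (-(c x y + f x + g y) / ε))

/-- The conditional plan given the first coordinate `x`:
`π(dy|x) = exp(-(c(x,y) + f(x) + g(y))/ε) ν(dy)`. -/
def condFst {X Y : Type*} [MeasurableSpace Y]
    (ν : Measure Y) (ε : ℝ) (c : X → Y → ℝ) (f : X → ℝ) (g : Y → ℝ) (x : X) : Measure Y :=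
  ν.withDensity fun y => ENNReal.ofReal (Real.exp (-(c x y + f x + g y) / ε))

/-- The logarithmic Sobolev inequality `LSI(C)` for `ρ`. -/
def LSI {F : Type*} [NormedAddCommGroup F] [InnerProductSpace ℝ F] [CompleteSpace F]
    [MeasurableSpace F] (C : ℝ) (ρ : Measure F) : Prop :=
  ∀ g : F → ℝ, Differentiable ℝ g → (∀ x, 0 < g x) →
    IsProbabilityMeasure (ρ.withDensity fun x => ENNReal.ofReal (g x)) →
    KL (ρ.withDensity fun x => ENNReal.ofReal (g x)) ρ ≤
      ENNReal.ofReal (C / 2 * ∫ x, ‖gradient (fun x' => Real.log (g x')) x‖ ^ 2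
        ∂(ρ.withDensity fun x => ENNReal.ofReal (g x)))

section ExpDensity

variable {α : Type*} [MeasurableSpace α] {m : Measure α} {g : α → ℝ}

lemma integrable_withDensity_exp_iff (hg : Measurable g) {f : α → ℝ} :
    Integrable f (m.withDensity fun x => ENNReal.ofReal (Real.exp (g x))) ↔
      Integrable (fun x => Real.exp (g x) * f x) m := by
  rw [integrable_withDensity_iff_integrable_smul' (by fun_prop) (by simp)]
  simp [ENNReal.toReal_ofReal, Real.exp_nonneg]

lemma integral_withDensity_exp (hg : Measurable g) (f : α → ℝ) :
    ∫ x, f x ∂(m.withDensity fun x => ENNReal.ofReal (Real.exp (g x))) =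
      ∫ x, Real.exp (g x) * f x ∂m := by
  rw [integral_withDensity_eq_integral_toReal_smul (by fun_prop) (by simp)]
  simp [ENNReal.toReal_ofReal, Real.exp_nonneg]

lemma withDensity_exp_withDensity_exp (hg : Measurable g) {h : α → ℝ} (hh : Measurable h) :
    (m.withDensity fun x => ENNReal.ofReal (Real.exp (g x))).withDensity
        (fun x => ENNReal.ofReal (Real.exp (h x))) =
      m.withDensity fun x => ENNReal.ofReal (Real.exp (g x + h x)) := by
  rw [← withDensity_mul _ (by fun_prop) (by fun_prop)]
  congr 1
  ext x
  simp [Real.exp_add, ENNReal.ofReal_mul, Real.exp_nonneg]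

end ExpDensity

lemma ae_mem_msupport {X : Type*} [MeasurableSpace X] [TopologicalSpace X]
    [SecondCountableTopology X] (ρ : Measure X) : ∀ᵐ x ∂ρ, x ∈ msupport ρ := by
  refine measure_null_of_locally_null _ fun x hx => ?_
  simp only [msupport, Set.mem_compl_iff, Set.mem_ofPred_eq, not_forall, not_lt,
    nonpos_iff_eq_zero] at hx
  obtain ⟨U, hU, hxU, h0⟩ := hx
  exact ⟨U, mem_nhdsWithin_of_mem_nhds (hU.mem_nhds hxU), h0⟩

section Semiconcave

variable {X : Type*} [MeasurableSpace X] {d : ℕ} {m : Measure X} [IsProbabilityMeasure m]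
  {ε Λ : ℝ} {f : X → EuclideanSpace ℝ (Fin d) → ℝ} {y : EuclideanSpace ℝ (Fin d)}
  {w : EuclideanSpace ℝ (Fin d) → ℝ}

lemma measurable_inner_gradient (hf : ∀ z, Measurable fun x => f x z)
    (hdiff : ∀ x, DifferentiableAt ℝ (f x) y) (v : EuclideanSpace ℝ (Fin d)) :
    Measurable fun x => ⟪gradient (f x) y, v⟫ := by
  have h : ∀ x, Tendsto (fun n : ℕ => (n : ℝ) * (f x (y + (n : ℝ)⁻¹ • v) - f x y)) atTop
      (nhds ⟪gradient (f x) y, v⟫) := by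
    intro x
    have := ((hdiff x).hasGradientAt.hasFDerivAt.lim_real v).comp tendsto_natCast_atTop_atTop
    simpa [Function.comp_def] using this
  refine measurable_of_tendsto_metrizable (fun n => ?_) (tendsto_pi_nhds.2 h)
  exact ((hf _).sub (hf _)).const_mul _

/-- Finiteness of the exponential moments of the increments of a semiconcave family makes its
gradient integrable. -/
lemma integrable_gradient_of_semiconcave (hε : 0 < ε) (hf : ∀ z, Measurable fun x => f x z)
    (hdiff : ∀ x, DifferentiableAt ℝ (f x) y)
    (hexp : ∀ z, Integrable (fun x => Real.exp (-(f x z - f x y) / ε)) m)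
    (hsc : ∀ᵐ x ∂m, ∀ z, f x z - f x y ≤ ⟪gradient (f x) y, z - y⟫ + Λ / 2 * w z) :
    Integrable (fun x => gradient (f x) y) m := by
  have hlow : ∀ v, ∀ᵐ x ∂m, ε * (1 - Real.exp (-(f x (y + v) - f x y) / ε)) - Λ / 2 * w (y + v)
      ≤ ⟪gradient (f x) y, v⟫ := by
    intro v
    filter_upwards [hsc] with x hx
    have h1 := hx (y + v)
    rw [add_sub_cancel_left] at h1
    have h2 := Real.add_one_le_exp (-(f x (y + v) - f x y) / ε)
    have h3 : ε * (-(f x (y + v) - f x y) / ε) = -(f x (y + v) - f x y) := by field_simp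
    nlinarith
  have hint : ∀ v, Integrable (fun x => ⟪gradient (f x) y, v⟫) m := by
    intro v
    have hl : ∀ v, Integrable (fun x =>
        ε * (1 - Real.exp (-(f x (y + v) - f x y) / ε)) - Λ / 2 * w (y + v)) m := fun v =>
      (((integrable_const 1).sub (hexp (y + v))).const_mul ε).sub (integrable_const _)
    refine integrable_of_le_of_le (measurable_inner_gradient hf hdiff v).aestronglyMeasurable
      (hlow v) ?_ (hl v) (hl (-v)).neg
    filter_upwards [hlow (-v)] with x hx
    rw [inner_neg_right] at hx
    simp only [Pi.neg_apply]
    linarith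
  refine Integrable.of_eval_piLp fun i => ?_
  simpa only [EuclideanSpace.inner_single_right, one_mul, conj_trivial] using
    hint (EuclideanSpace.single i 1)

/-- A Donsker-Varadhan type estimate along a semiconcave family whose gradient has mean zero. -/
lemma integral_le_of_semiconcave (hε : 0 < ε) (hf : ∀ z, Measurable fun x => f x z)
    (hdiff : ∀ x, DifferentiableAt ℝ (f x) y)
    (hexp : ∀ z, Integrable (fun x => Real.exp (-(f x z - f x y) / ε)) m)
    (hsc : ∀ᵐ x ∂m, ∀ z, f x z - f x y ≤ ⟪gradient (f x) y, z - y⟫ + Λ / 2 * w z)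
    (hgrad : Integrable (fun x => gradient (f x) y) m → ∫ x, gradient (f x) y ∂m = 0)
    (z : EuclideanSpace ℝ (Fin d)) {u : X → ℝ} (hu : Integrable u m)
    (hexpu : Integrable (fun x => Real.exp (-(f x z - f x y) / ε) * Real.exp (u x)) m) :
    ∫ x, u x ∂m ≤ Λ / (2 * ε) * w z +
      ∫ x, Real.exp (-(f x z - f x y) / ε) * Real.exp (u x) ∂m - 1 := by
  have hG := integrable_gradient_of_semiconcave hε hf hdiff hexp hsc
  have hGi : Integrable (fun x => ⟪gradient (f x) y, z - y⟫) m := hG.inner_const _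
  have hG0 : ∫ x, ⟪gradient (f x) y, z - y⟫ ∂m = 0 := by
    simp_rw [real_inner_comm (z - y)]
    rw [integral_inner hG, hgrad hG, inner_zero_right]
  have hA : Integrable (fun x => ⟪gradient (f x) y, z - y⟫ * ε⁻¹ + (Λ / (2 * ε) * w z - 1)) m :=
    (hGi.mul_const _).add (integrable_const _)
  calc ∫ x, u x ∂m
      ≤ ∫ x, (⟪gradient (f x) y, z - y⟫ * ε⁻¹ + (Λ / (2 * ε) * w z - 1)
          + Real.exp (-(f x z - f x y) / ε) * Real.exp (u x)) ∂m := by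
        refine integral_mono_ae hu (hA.add hexpu) ?_
        filter_upwards [hsc] with x hx
        have h1 := mul_le_mul_of_nonneg_right (hx z) (inv_nonneg.2 hε.le)
        have h2 := Real.add_one_le_exp (-(f x z - f x y) / ε + u x)
        rw [Real.exp_add] at h2
        have h3 : (⟪gradient (f x) y, z - y⟫ + Λ / 2 * w z) * ε⁻¹ =
          ⟪gradient (f x) y, z - y⟫ * ε⁻¹ + Λ / (2 * ε) * w z := by field_simp
        have h4 : -(f x z - f x y) / ε = -((f x z - f x y) * ε⁻¹) := by ring
        linarith
    _ = _ := by
        rw [integral_add hA hexpu,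
          integral_add (hGi.mul_const _) (integrable_const _), integral_mul_const, hG0]
        simp
        ring

end Semiconcave

section Truncation

/-- Truncation of a real number to `[-n, n]`. -/
def trunc (n : ℕ) (t : ℝ) : ℝ := max (-n) (min t n)

lemma abs_trunc_le (n : ℕ) (t : ℝ) : |trunc n t| ≤ n := by
  have : (0 : ℝ) ≤ n := n.cast_nonneg
  exact abs_le.2 ⟨le_max_left _ _, max_le (by linarith) (min_le_right _ _)⟩

@[fun_prop]
lemma measurable_trunc (n : ℕ) : Measurable (trunc n) := by
  unfold trunc
  fun_prop

lemma tendsto_trunc (t : ℝ) : Tendsto (fun n => trunc n t) atTop (nhds t) := by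
  obtain ⟨N, hN⟩ := exists_nat_ge |t|
  refine tendsto_const_nhds.congr' ?_
  filter_upwards [eventually_ge_atTop N] with n hn
  have : (N : ℝ) ≤ n := by exact_mod_cast hn
  obtain ⟨h1, h2⟩ := abs_le.1 (hN.trans this)
  rw [trunc, min_eq_left h2, max_eq_right h1]

lemma trunc_add_trunc_mem (n : ℕ) (s t : ℝ) :
    min 0 (s + t) ≤ trunc n s + trunc n t ∧ trunc n s + trunc n t ≤ max 0 (s + t) := by
  have : (0 : ℝ) ≤ n := n.cast_nonneg
  unfold trunc
  grind

end Truncation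

section Plan

variable {X Y : Type*} [MeasurableSpace X] [MeasurableSpace Y] {ρ : Measure X} {μ ν : Measure Y}
  {ε : ℝ} {c : X → Y → ℝ} {f f' : X → ℝ} {g g' : Y → ℝ}

lemma plan_withDensity [SFinite μ] (hc : Measurable (Function.uncurry c))
    (hf : Measurable f) (hg : Measurable g) (hf' : Measurable f') (hg' : Measurable g') :
    (plan ρ μ ε c f g).withDensity (fun p => ENNReal.ofReal
      (Real.exp ((f p.1 - f' p.1) / ε + (g p.2 - g' p.2) / ε))) = plan ρ μ ε c f' g' := by
  have hc' : Measurable fun p : X × Y => c p.1 p.2 := hc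
  unfold plan
  rw [withDensity_exp_withDensity_exp (by fun_prop) (by fun_prop)]
  congr 1
  ext p
  congr 2
  ring

lemma condSnd_withDensity (hc : Measurable (Function.uncurry c)) (hf : Measurable f) (y z : Y) :
    (condSnd ρ ε c f g y).withDensity (fun x => ENNReal.ofReal
      (Real.exp (-((c x z + g z) - (c x y + g y)) / ε))) = condSnd ρ ε c f g z := by
  have hc' : ∀ y, Measurable fun x => c x y := fun y => hc.comp measurable_prodMk_right
  unfold condSnd
  rw [withDensity_exp_withDensity_exp (by fun_prop) (by fun_prop)]
  congr 1
  ext x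
  congr 2
  ring

lemma integral_plan [SFinite ρ] [SFinite μ] (hc : Measurable (Function.uncurry c))
    (hf : Measurable f) (hg : Measurable g) {F : X × Y → ℝ}
    (hF : Integrable F (plan ρ μ ε c f g)) :
    Integrable (fun y => ∫ x, F (x, y) ∂(condSnd ρ ε c f g y)) μ ∧
      ∫ y, ∫ x, F (x, y) ∂(condSnd ρ ε c f g y) ∂μ = ∫ p, F p ∂(plan ρ μ ε c f g) := by
  have hc' : Measurable fun p : X × Y => c p.1 p.2 := hc
  have hexp : Measurable fun p : X × Y => -(c p.1 p.2 + f p.1 + g p.2) / ε := by fun_prop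
  unfold plan condSnd at *
  rw [integrable_withDensity_exp_iff hexp] at hF
  rw [integral_withDensity_exp hexp, integral_prod_symm _ hF]
  have h : ∀ y, ∫ x, F (x, y) ∂(ρ.withDensity fun x =>
      ENNReal.ofReal (Real.exp (-(c x y + f x + g y) / ε))) =
      ∫ x, Real.exp (-(c x y + f x + g y) / ε) * F (x, y) ∂ρ :=
    fun y => integral_withDensity_exp (hexp.comp measurable_prodMk_right) _
  simp_rw [h]
  exact ⟨hF.integral_prod_right, trivial⟩

lemma isProbabilityMeasure_plan [SFinite ρ] [IsProbabilityMeasure μ]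
    (hc : Measurable (Function.uncurry c)) (hf : Measurable f) (hg : Measurable g)
    (hcond : ∀ y, IsProbabilityMeasure (condSnd ρ ε c f g y)) :
    IsProbabilityMeasure (plan ρ μ ε c f g) := by
  have hc' : Measurable fun p : X × Y => c p.1 p.2 := hc
  have h : ∀ y, ∫⁻ x, ENNReal.ofReal (Real.exp (-(c x y + f x + g y) / ε)) ∂ρ = 1 := by
    intro y
    rw [← (hcond y).measure_univ, condSnd, withDensity_apply _ MeasurableSet.univ,
      Measure.restrict_univ]
  refine ⟨?_⟩
  rw [plan, withDensity_apply _ MeasurableSet.univ, Measure.restrict_univ,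
    lintegral_prod_symm _ (by fun_prop)]
  simp only [h, lintegral_one, measure_univ]

lemma plan_eq_withDensity_rnDeriv [SFinite ρ] [SigmaFinite μ] [SigmaFinite ν]
    (hc : Measurable (Function.uncurry c))
    (hf : Measurable f) (hg : Measurable g) (hf' : Measurable f') (hg' : Measurable g')
    (hμν : μ ≪ ν) :
    plan ρ μ ε c f' g' = (plan ρ ν ε c f g).withDensity (fun p => ENNReal.ofReal
      (Real.exp ((f p.1 - f' p.1) / ε + (g p.2 - g' p.2) / ε)) * μ.rnDeriv ν p.2) := by
  have hc' : Measurable fun p : X × Y => c p.1 p.2 := hc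
  have hr : Measurable (μ.rnDeriv ν) := Measure.measurable_rnDeriv μ ν
  have hprod : ρ.prod μ = (ρ.prod ν).withDensity fun p => μ.rnDeriv ν p.2 := by
    rw [← prod_withDensity_right hr, Measure.withDensity_rnDeriv_eq _ _ hμν]
  rw [← plan_withDensity hc hf hg hf' hg']
  unfold plan
  rw [hprod, ← withDensity_mul _ (by fun_prop) (by fun_prop),
    ← withDensity_mul _ (by fun_prop) (by fun_prop),
    ← withDensity_mul _ (by fun_prop) (by fun_prop)]
  congr 1
  ext p
  simp only [Pi.mul_apply]
  ring

lemma log_rnDeriv_plan [SFinite ρ] [SigmaFinite μ] [SigmaFinite ν]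
    (hc : Measurable (Function.uncurry c))
    (hf : Measurable f) (hg : Measurable g) (hf' : Measurable f') (hg' : Measurable g')
    (hμν : μ ≪ ν) [IsFiniteMeasure (plan ρ ν ε c f g)]
    (hsnd : (plan ρ μ ε c f' g').map Prod.snd = μ) :
    ∀ᵐ p ∂(plan ρ μ ε c f' g'),
      Real.log ((plan ρ μ ε c f' g').rnDeriv (plan ρ ν ε c f g) p).toReal =
        (f p.1 - f' p.1) / ε + (g p.2 - g' p.2) / ε + llr μ ν p.2 := by
  have hr : Measurable (μ.rnDeriv ν) := Measure.measurable_rnDeriv μ ν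
  have heq := plan_eq_withDensity_rnDeriv (ρ := ρ) (ε := ε) hc hf hg hf' hg' hμν
  have hac : plan ρ μ ε c f' g' ≪ plan ρ ν ε c f g := by
    rw [heq]
    exact withDensity_absolutelyContinuous _ _
  have h1 := hac.ae_le (Measure.rnDeriv_withDensity (plan ρ ν ε c f g)
    (f := fun p => ENNReal.ofReal
      (Real.exp ((f p.1 - f' p.1) / ε + (g p.2 - g' p.2) / ε)) * μ.rnDeriv ν p.2) (by fun_prop))
  rw [← heq] at h1
  have h2 : ∀ᵐ y ∂((plan ρ μ ε c f' g').map Prod.snd),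
      0 < μ.rnDeriv ν y ∧ μ.rnDeriv ν y < ⊤ := by
    rw [hsnd]
    exact (Measure.rnDeriv_pos hμν).and (hμν.ae_le (Measure.rnDeriv_lt_top μ ν))
  filter_upwards [h1, ae_of_ae_map measurable_snd.aemeasurable h2] with p hp hp'
  rw [hp, ENNReal.toReal_mul, ENNReal.toReal_ofReal (Real.exp_nonneg _),
    Real.log_mul (Real.exp_pos _).ne' (ENNReal.toReal_pos hp'.1.ne' hp'.2.ne).ne', Real.log_exp,
    llr]

lemma integrable_of_bounded {α : Type*} [MeasurableSpace α] {m : Measure α} [IsFiniteMeasure m]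
    {u : α → ℝ} (hu : Measurable u) {M : ℝ} (hM : ∀ x, |u x| ≤ M) : Integrable u m :=
  Integrable.of_bound hu.aestronglyMeasurable M (ae_of_all _ hM)

/-- The dual bound for bounded test functions, obtained by integrating a fibrewise bound against
a coupling. -/
lemma integral_add_integral_le_of_coupling [IsProbabilityMeasure μ]
    [SFinite ρ] [SFinite ν]
    (hc : Measurable (Function.uncurry c)) (hf : Measurable f) (hg : Measurable g)
    (hcond : ∀ y, IsProbabilityMeasure (condSnd ρ ε c f g y))
    [IsProbabilityMeasure (plan ρ ν ε c f g)] (hfst : (plan ρ ν ε c f g).map Prod.fst = ρ)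
    {P : Measure (Y × Y)} (hP1 : P.map Prod.fst = μ) (hP2 : P.map Prod.snd = ν)
    {k : Y → Y → ℝ} (hk : Integrable (fun p => k p.1 p.2) P)
    {u : X → ℝ} {v : Y → ℝ} (hu : Measurable u) (hv : Measurable v) {M : ℝ}
    (huM : ∀ x, |u x| ≤ M) (hvM : ∀ y, |v y| ≤ M)
    (hfib : ∀ y z, ∫ x, (u x + v z) ∂(condSnd ρ ε c f g y) ≤
      k z y + ∫ x, Real.exp (u x + v z) ∂(condSnd ρ ε c f g z) - 1) :
    ∫ x, u x ∂ρ + ∫ y, v y ∂μ ≤ ∫ p, k p.1 p.2 ∂P +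
      ∫ p, Real.exp (u p.1 + v p.2) ∂(plan ρ μ ε c f g) - 1 := by
  have hPprob : IsProbabilityMeasure P := by
    have : IsProbabilityMeasure (P.map Prod.fst) := by rwa [hP1]
    exact Measure.isProbabilityMeasure_of_map (μ := P) Prod.fst
  have := isProbabilityMeasure_plan (μ := μ) hc hf hg hcond
  obtain ⟨hU, hUeq⟩ := integral_plan (F := fun p => u p.1) hc hf hg
    (integrable_of_bounded (m := plan ρ ν ε c f g) (by fun_prop) fun p => huM p.1)
  obtain ⟨hV, hVeq⟩ := integral_plan (F := fun p => Real.exp (u p.1 + v p.2)) hc hf hg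
    (integrable_of_bounded (m := plan ρ μ ε c f g) (M := Real.exp (M + M)) (by fun_prop) fun p => by
      rw [abs_of_pos (Real.exp_pos _)]
      exact Real.exp_le_exp.2 (add_le_add (le_of_abs_le (huM _)) (le_of_abs_le (hvM _))))
  have hvi : Integrable v μ := integrable_of_bounded hv hvM
  have hUρ : ∫ p, u p.1 ∂(plan ρ ν ε c f g) = ∫ x, u x ∂ρ := by
    conv_rhs => rw [← hfst]
    rw [integral_map measurable_fst.aemeasurable hu.aestronglyMeasurable]
  rw [← hVeq, ← hUρ, ← hUeq]
  set U := fun y => ∫ x, u x ∂(condSnd ρ ε c f g y)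
  set V := fun y => ∫ x, Real.exp (u x + v y) ∂(condSnd ρ ε c f g y)
  have hpt : ∀ p : Y × Y, U p.2 + v p.1 ≤ k p.1 p.2 + V p.1 - 1 := by
    intro p
    have := hfib p.2 p.1
    rw [integral_add (integrable_of_bounded hu huM) (integrable_const _)] at this
    simpa using this
  rw [← hP2] at hU ⊢
  rw [← hP1] at hV hvi ⊢
  rw [integral_map measurable_snd.aemeasurable hU.aestronglyMeasurable,
    integral_map measurable_fst.aemeasurable hV.aestronglyMeasurable,
    integral_map measurable_fst.aemeasurable hvi.aestronglyMeasurable]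
  have hU' : Integrable (fun p : Y × Y => U p.2) P := hU.comp_measurable measurable_snd
  have hV' : Integrable (fun p : Y × Y => V p.1) P := hV.comp_measurable measurable_fst
  have hv' : Integrable (fun p : Y × Y => v p.1) P := hvi.comp_measurable measurable_fst
  have hkV : Integrable (fun p : Y × Y => k p.1 p.2 + V p.1) P := hk.add hV'
  have := integral_mono (hU'.add hv') (hkV.sub (integrable_const 1)) hpt
  simp only [Pi.add_apply, Pi.sub_apply] at this
  rw [integral_add hU' hv', integral_sub hkV (integrable_const _), integral_add hk hV'] at this
  simpa using this

/-- The bound for bounded test functions passes to the limit in the truncation. -/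
lemma integral_le_of_forall_bounded
    (hf : Measurable f) (hg : Measurable g) {τ Q : Measure (X × Y)} [IsProbabilityMeasure τ]
    [IsProbabilityMeasure Q]
    (hQ : τ.withDensity (fun p => ENNReal.ofReal (Real.exp (f p.1 + g p.2))) = Q)
    (hfst : Q.map Prod.fst = ρ) (hsnd : Q.map Prod.snd = μ)
    (hint : Integrable (fun p => f p.1 + g p.2) Q) {K : ℝ}
    (hK : ∀ (u : X → ℝ) (v : Y → ℝ) (M : ℝ), Measurable u → Measurable v → (∀ x, |u x| ≤ M) →
      (∀ y, |v y| ≤ M) →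
      ∫ x, u x ∂ρ + ∫ y, v y ∂μ ≤ K + ∫ p, Real.exp (u p.1 + v p.2) ∂τ - 1) :
    ∫ p, (f p.1 + g p.2) ∂Q ≤ K := by
  have hfg : Measurable fun p : X × Y => f p.1 + g p.2 := by fun_prop
  have hexp : Integrable (fun p => Real.exp (f p.1 + g p.2)) τ ∧
      ∫ p, Real.exp (f p.1 + g p.2) ∂τ = 1 := by
    have h1 : Integrable (fun _ => (1 : ℝ)) Q := integrable_const 1
    have h2 : ∫ _, (1 : ℝ) ∂Q = 1 := by simp
    rw [← hQ] at h1 h2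
    rw [integrable_withDensity_exp_iff hfg] at h1
    rw [integral_withDensity_exp hfg] at h2
    simpa using And.intro h1 h2
  have hl : Tendsto (fun n => ∫ p, (trunc n (f p.1) + trunc n (g p.2)) ∂Q) atTop
      (nhds (∫ p, (f p.1 + g p.2) ∂Q)) := by
    refine tendsto_integral_of_dominated_convergence (fun p => |f p.1 + g p.2|)
      (fun n => Measurable.aestronglyMeasurable (by fun_prop)) hint.abs
      (fun n => ae_of_all _ fun p => ?_)
      (ae_of_all _ fun p => (tendsto_trunc _).add (tendsto_trunc _))
    have := trunc_add_trunc_mem n (f p.1) (g p.2)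
    rw [Real.norm_eq_abs]
    grind
  have hr : Tendsto (fun n => ∫ p, Real.exp (trunc n (f p.1) + trunc n (g p.2)) ∂τ) atTop
      (nhds 1) := by
    rw [← hexp.2]
    refine tendsto_integral_of_dominated_convergence (fun p => 1 + Real.exp (f p.1 + g p.2))
      (fun n => Measurable.aestronglyMeasurable (by fun_prop))
      ((integrable_const 1).add hexp.1) (fun n => ae_of_all _ fun p => ?_)
      (ae_of_all _ fun p =>
        (Real.continuous_exp.tendsto _).comp ((tendsto_trunc _).add (tendsto_trunc _)))
    rw [Real.norm_eq_abs, abs_of_pos (Real.exp_pos _)]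
    have h := Real.exp_le_exp.2 (trunc_add_trunc_mem n (f p.1) (g p.2)).2
    rcases max_choice 0 (f p.1 + g p.2) with h0 | h0 <;> rw [h0] at h
    · rw [Real.exp_zero] at h
      linarith [Real.exp_pos (f p.1 + g p.2)]
    · linarith
  have hlim : Tendsto (fun n => K + ∫ p, Real.exp (trunc n (f p.1) + trunc n (g p.2)) ∂τ - 1)
      atTop (nhds K) := by
    simpa using (hr.const_add K).sub_const 1
  refine le_of_tendsto_of_tendsto' hl hlim fun n => ?_
  have h := hK (fun x => trunc n (f x)) (fun y => trunc n (g y)) n (by fun_prop) (by fun_prop)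
    (fun x => abs_trunc_le n _) (fun y => abs_trunc_le n _)
  have h1 : Integrable (fun p : X × Y => trunc n (f p.1)) Q :=
    integrable_of_bounded (by fun_prop) fun p => abs_trunc_le n _
  have h2 : Integrable (fun p : X × Y => trunc n (g p.2)) Q :=
    integrable_of_bounded (by fun_prop) fun p => abs_trunc_le n _
  rw [integral_add h1 h2]
  rw [← hfst, ← hsnd, integral_map measurable_fst.aemeasurable
      (Measurable.aestronglyMeasurable (by fun_prop)),
    integral_map measurable_snd.aemeasurable
      (Measurable.aestronglyMeasurable (by fun_prop))] at h
  exact h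

/-- Data processing: if the log-likelihood ratio of the plans is integrable, so is that of their
second marginals. -/
lemma integrable_llr_snd [IsFiniteMeasure μ] [IsFiniteMeasure ν] (hμν : μ ≪ ν)
    (hf : Measurable f) (hg : Measurable g) {τ Q : Measure (X × Y)} [IsFiniteMeasure τ]
    (hQ : τ.withDensity (fun p => ENNReal.ofReal (Real.exp (f p.1 + g p.2))) = Q)
    (hsnd : Q.map Prod.snd = μ)
    (hint : Integrable (fun p => f p.1 + g p.2 + llr μ ν p.2) Q) :
    Integrable (fun p => llr μ ν p.2) Q := by
  have hl : Measurable (llr μ ν) := measurable_llr μ ν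
  have hfg : Measurable fun p : X × Y => f p.1 + g p.2 := by fun_prop
  have hup : Integrable (fun p => Real.exp (-(f p.1 + g p.2))) Q := by
    rw [← hQ, integrable_withDensity_exp_iff hfg]
    simp [← Real.exp_add]
  have hlow : Integrable (fun y => Real.exp (-llr μ ν y)) μ :=
    (Measure.integrable_toReal_rnDeriv (μ := ν) (ν := μ)).congr (exp_neg_llr hμν).symm
  rw [← hsnd] at hlow
  refine integrable_of_le_of_le (Measurable.aestronglyMeasurable (by fun_prop))
    (ae_of_all _ fun p => ?_) (ae_of_all _ fun p => ?_)
    (hlow.comp_measurable measurable_snd).neg (hint.add hup)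
  · have := Real.add_one_le_exp (-llr μ ν p.2)
    simp only [Pi.neg_apply, Function.comp_apply, hsnd]
    linarith
  · have := Real.add_one_le_exp (-(f p.1 + g p.2))
    simp only [Pi.add_apply]
    linarith

end Plan

/-- **KL stability of optimal plans, generalized** (Theorem 1.3). -/
theorem kl_stability_of_optimal_plans_generalized
    {X : Type*} [MeasurableSpace X] [TopologicalSpace X] [PolishSpace X] [BorelSpace X]
    {d : ℕ} (ρ : Measure X) [IsProbabilityMeasure ρ]
    (μ ν : Measure (EuclideanSpace ℝ (Fin d))) [IsProbabilityMeasure μ] [IsProbabilityMeasure ν]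
    (ε : ℝ) (hε : 0 < ε)
    (c : X → EuclideanSpace ℝ (Fin d) → ℝ)
    (hc_meas : Measurable (Function.uncurry c))
    (hc_smooth : ∀ x, ContDiff ℝ 1 (c x))
    (ω : EuclideanSpace ℝ (Fin d) → EuclideanSpace ℝ (Fin d) → ℝ)
    (hω_meas : Measurable (Function.uncurry ω))
    (hω_nonneg : ∀ z y, 0 ≤ ω z y)
    (φν : X → ℝ) (ψν : EuclideanSpace ℝ (Fin d) → ℝ) (φμ : X → ℝ) (ψμ : EuclideanSpace ℝ (Fin d) → ℝ)
    (hφν_meas : Measurable φν) (hψν_meas : Measurable ψν)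
    (hφμ_meas : Measurable φμ) (hψμ_meas : Measurable ψμ)
    (hπν_prob : IsProbabilityMeasure (plan ρ ν ε c φν ψν))
    (hπν_fst : (plan ρ ν ε c φν ψν).map Prod.fst = ρ)
    (hπν_snd : (plan ρ ν ε c φν ψν).map Prod.snd = ν)
    (hπμ_prob : IsProbabilityMeasure (plan ρ μ ε c φμ ψμ))
    (hπμ_fst : (plan ρ μ ε c φμ ψμ).map Prod.fst = ρ)
    (hπμ_snd : (plan ρ μ ε c φμ ψμ).map Prod.snd = μ)
    (hcond : ∀ y, IsProbabilityMeasure (condSnd ρ ε c φν ψν y))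
    (hψν_diff : Differentiable ℝ ψν)
    (hψν_grad : ∀ y, gradient ψν y = -∫ x, gradient (c x) y ∂(condSnd ρ ε c φν ψν y))
    (Λ : ℝ) (hΛ : 0 < Λ)
    (hsc : ∀ x ∈ msupport ρ, SemiconcaveW Λ ω (fun y => c x y + ψν y)) :
    KL (plan ρ μ ε c φμ ψμ) (plan ρ ν ε c φν ψν)
      ≤ KL μ ν + ENNReal.ofReal (Λ / (2 * ε)) * Wcost ω μ ν := by
  have hc_sec : ∀ z, Measurable fun x => c x z := fun z => hc_meas.comp measurable_prodMk_right
  have hc_diff : ∀ x y, DifferentiableAt ℝ (c x) y :=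
    fun x y => ((hc_smooth x).differentiable one_ne_zero).differentiableAt
  have hgrad_add : ∀ x y,
      gradient (fun y => c x y + ψν y) y = gradient (c x) y + gradient ψν y := by
    intro x y
    simp only [gradient, ← map_add]
    rw [fderiv_fun_add (hc_diff x y) (hψν_diff y)]
  have hR := isProbabilityMeasure_plan (μ := μ) hc_meas hφν_meas hψν_meas hcond
  have hQ := plan_withDensity (ρ := ρ) (μ := μ) (ε := ε) hc_meas hφν_meas hψν_meas
    hφμ_meas hψμ_meas
  by_cases hμν : μ ≪ ν
  swap
  · simp [KL, hμν]
  have hac : plan ρ μ ε c φμ ψμ ≪ plan ρ ν ε c φν ψν := by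
    rw [plan_eq_withDensity_rnDeriv hc_meas hφν_meas hψν_meas hφμ_meas hψμ_meas hμν]
    exact withDensity_absolutelyContinuous _ _
  have hlog := log_rnDeriv_plan hc_meas hφν_meas hψν_meas hφμ_meas hψμ_meas hμν hπμ_snd
  rw [KL, if_pos hac, KL, if_pos hμν, integral_congr_ae hlog]
  by_cases hint : Integrable (fun p : X × EuclideanSpace ℝ (Fin d) =>
      (φν p.1 - φμ p.1) / ε + (ψν p.2 - ψμ p.2) / ε + llr μ ν p.2) (plan ρ μ ε c φμ ψμ)
  swap
  · simp [integral_undef hint]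
  have hllr := integrable_llr_snd (f := fun x => (φν x - φμ x) / ε)
    (g := fun y => (ψν y - ψμ y) / ε) hμν (by fun_prop) (by fun_prop) hQ hπμ_snd hint
  have hab : Integrable (fun p : X × EuclideanSpace ℝ (Fin d) =>
      (φν p.1 - φμ p.1) / ε + (ψν p.2 - ψμ p.2) / ε) (plan ρ μ ε c φμ ψμ) :=
    (hint.sub hllr).congr (ae_of_all _ fun p => by simp)
  have hllr_eq : ∫ p, llr μ ν p.2 ∂(plan ρ μ ε c φμ ψμ) = ∫ y, llr μ ν y ∂μ := by
    rw [← integral_map (φ := Prod.snd) (f := llr μ ν) measurable_snd.aemeasurable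
      (measurable_llr μ ν).aestronglyMeasurable, hπμ_snd]
  rw [integral_add hab hllr, hllr_eq, add_comm]
  refine ENNReal.ofReal_add_le.trans (add_le_add le_rfl ?_)
  have hK : 0 < Λ / (2 * ε) := by positivity
  rw [← ENNReal.div_le_iff' (by simp [hK]) ENNReal.ofReal_ne_top, Wcost]
  refine le_iInf₂ fun P hP => ?_
  rw [ENNReal.div_le_iff' (by simp [hK]) ENNReal.ofReal_ne_top]
  have hω' : Measurable fun p : EuclideanSpace ℝ (Fin d) × EuclideanSpace ℝ (Fin d) =>
    ω p.1 p.2 := hω_meas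
  by_cases hωP : ∫⁻ p, ENNReal.ofReal (ω p.1 p.2) ∂P = ⊤
  · rw [hωP, ENNReal.mul_top (by simp [hK])]
    exact le_top
  have hωi : Integrable (fun p => ω p.1 p.2) P := by
    refine ⟨hω'.aestronglyMeasurable, ?_⟩
    rw [hasFiniteIntegral_iff_ofReal (ae_of_all _ fun p => hω_nonneg _ _)]
    exact lt_top_iff_ne_top.2 hωP
  rw [← ofReal_integral_eq_lintegral_ofReal hωi (ae_of_all _ fun p => hω_nonneg _ _),
    ← ENNReal.ofReal_mul hK.le, ← integral_const_mul]
  refine ENNReal.ofReal_le_ofReal ?_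
  refine integral_le_of_forall_bounded (f := fun x => (φν x - φμ x) / ε)
    (g := fun y => (ψν y - ψμ y) / ε) (by fun_prop) (by fun_prop) hQ hπμ_fst hπμ_snd hab ?_
  intro u v M hu hv huM hvM
  refine integral_add_integral_le_of_coupling (k := fun z y => Λ / (2 * ε) * ω z y) hc_meas
    hφν_meas hψν_meas hcond hπν_fst hP.1 hP.2 (hωi.const_mul _) hu hv huM hvM ?_
  intro y z
  have hwd : ∀ z, (condSnd ρ ε c φν ψν y).withDensity (fun x => ENNReal.ofReal
      (Real.exp (-((c x z + ψν z) - (c x y + ψν y)) / ε))) = condSnd ρ ε c φν ψν z :=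
    condSnd_withDensity hc_meas hφν_meas y
  have hmeas : ∀ z, Measurable fun x => -((c x z + ψν z) - (c x y + ψν y)) / ε := by
    intro z
    fun_prop
  have huv : Integrable (fun x => Real.exp (u x + v z)) (condSnd ρ ε c φν ψν z) :=
    integrable_of_bounded (M := Real.exp (M + M)) (by fun_prop) fun x => by
      rw [abs_of_pos (Real.exp_pos _)]
      exact Real.exp_le_exp.2 (add_le_add (le_of_abs_le (huM _)) (le_of_abs_le (hvM _)))
  have huv' := huv
  rw [← hwd z, integrable_withDensity_exp_iff (hmeas z)] at huv'
  have key := integral_le_of_semiconcave (m := condSnd ρ ε c φν ψν y) (ε := ε) (Λ := Λ)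
    (f := fun x y => c x y + ψν y) (y := y) (w := fun z => ω z y) (u := fun x => u x + v z) hε
    (fun z => (hc_sec z).add_const _) (fun x => (hc_diff x y).add (hψν_diff y)) ?_ ?_ ?_ z
    ((integrable_of_bounded hu huM).add (integrable_const _)) huv'
  · rwa [← integral_withDensity_exp (hmeas z), hwd z] at key
  · intro z
    have h1 : Integrable (fun _ => (1 : ℝ)) (condSnd ρ ε c φν ψν z) := integrable_const 1
    rw [← hwd z, integrable_withDensity_exp_iff (hmeas z)] at h1
    simpa using h1
  · have hcac : condSnd ρ ε c φν ψν y ≪ ρ := withDensity_absolutelyContinuous _ _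
    filter_upwards [hcac.ae_le (ae_mem_msupport ρ)] with x hx z
    exact hsc x hx y z
  · intro hi
    simp only [hgrad_add] at hi ⊢
    have hi' : Integrable (fun x => gradient (c x) y) (condSnd ρ ε c φν ψν y) :=
      (hi.sub (integrable_const (gradient ψν y))).congr (ae_of_all _ fun x => by simp)
    rw [integral_add hi' (integrable_const _), hψν_grad y]
    simp
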